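/- arXiv:1810.04870 — 3 statements merged into one kernel-verified Lean document; each statement's English description precedes it below -/
import Mathlib

section
/- Let G be a connected simple graph on n vertices. Then the path spectral radius satisfies ρ(G) ≤ (n − 1)², with equality if and only if G is the complete graph K_n. -/
open SimpleGraph Polynomial

/-- Two walks from `u` to `v` are *internally disjoint* if their supports
meet only in the endpoints `u` and `v`. -/
def InternallyDisjoint {V : Type*} {G : SimpleGraph V} {u v : V}
    (p q : G.Walk u v) : Prop :=
  ∀ w, w ∈ p.support → w ∈ q.support → w = u ∨ w = v

/-- The maximum number of pairwise internally vertex-disjoint paths from `u` to `v`. -/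
noncomputable def maxDisjointPaths {V : Type*} (G : SimpleGraph V) (u v : V) : ℕ :=
  sSup {m : ℕ | ∃ f : Fin m → G.Path u v, Function.Injective f ∧
    ∀ i j, i ≠ j → InternallyDisjoint (f i).1 (f j).1}

/-- The path matrix of a graph on `Fin n`. -/
noncomputable def pathMatrix {n : ℕ} (G : SimpleGraph (Fin n)) :
    Matrix (Fin n) (Fin n) ℝ :=
  Matrix.of fun i j => if i = j then 0 else (maxDisjointPaths G i j : ℝ)

/-- The path energy: sum of the absolute values of the eigenvalues of the path matrix
(the roots, with multiplicity, of its characteristic polynomial). -/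
noncomputable def pathEnergy {n : ℕ} (G : SimpleGraph (Fin n)) : ℝ :=
  ((pathMatrix G).charpoly.roots.map (fun x => |x|)).sum

/-- The path spectral radius: the largest eigenvalue of the path matrix. -/
noncomputable def pathSpectralRadius {n : ℕ} (G : SimpleGraph (Fin n)) : ℝ :=
  sSup {x : ℝ | (pathMatrix G).charpoly.IsRoot x}

/-- A path from `u` to `v ≠ u` whose second vertex is `v` is a single edge. -/
theorem SimpleGraph.Walk.IsPath.length_eq_one_of_snd_eq {V : Type*} {G : SimpleGraph V} {u v : V}
    {p : G.Walk u v} (hp : p.IsPath) (huv : u ≠ v) (h : p.snd = v) : p.length = 1 := by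
  cases p with
  | nil => exact absurd rfl huv
  | cons hadj q =>
    rw [Walk.snd_cons] at h
    subst h
    simp [Walk.length_eq_zero_iff.2 (Walk.isPath_iff_nil.1 hp.of_cons)]

theorem SimpleGraph.Walk.eq_of_length_eq_one {V : Type*} {G : SimpleGraph V} {u v : V}
    {p q : G.Walk u v} (hp : p.length = 1) (hq : q.length = 1) : p = q := by
  cases p with
  | nil => simp at hp
  | cons h p =>
    cases p with
    | cons _ _ => simp at hp
    | nil =>
      cases q with
      | nil => simp at hq
      | cons h' q =>
        cases q with
        | cons _ _ => simp at hq
        | nil => rfl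

theorem card_le_degree_of_internallyDisjoint {V : Type*} [Fintype V] {G : SimpleGraph V}
    [DecidableRel G.Adj] {u v : V} (huv : u ≠ v) {m : ℕ} (f : Fin m → G.Path u v)
    (hf : Function.Injective f)
    (hd : ∀ i j, i ≠ j → InternallyDisjoint (f i).1 (f j).1) : m ≤ G.degree u := by
  have hnil (i : Fin m) : ¬ (f i).1.Nil := Walk.not_nil_of_ne huv
  let g : Fin m → G.neighborSet u := fun i => ⟨(f i).1.snd, (f i).1.adj_snd (hnil i)⟩
  have hg : Function.Injective g := by
    intro i j hij
    by_contra hne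
    have hs : (f i).1.snd = (f j).1.snd := congrArg Subtype.val hij
    have hi : (f i).1.snd ∈ (f i).1.support := Walk.getVert_mem_support _ _
    have hj : (f i).1.snd ∈ (f j).1.support := hs ▸ Walk.getVert_mem_support _ _
    rcases hd i j hne _ hi hj with h | h
    · exact ((f i).1.adj_snd (hnil i)).ne h.symm
    · exact hne (hf (Subtype.ext (Walk.eq_of_length_eq_one
        ((f i).2.length_eq_one_of_snd_eq huv h)
        ((f j).2.length_eq_one_of_snd_eq huv (hs ▸ h)))))
  simpa only [Fintype.card_fin, card_neighborSet_eq_degree] using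
    Fintype.card_le_of_injective g hg

theorem maxDisjointPaths_le_degree {V : Type*} [Fintype V] (G : SimpleGraph V)
    [DecidableRel G.Adj] {u v : V} (huv : u ≠ v) : maxDisjointPaths G u v ≤ G.degree u := by
  refine csSup_le' ?_
  rintro m ⟨f, hf, hd⟩
  exact card_le_degree_of_internallyDisjoint huv f hf hd

theorem exists_path_top_through {V : Type*} {u v w : V} (huv : u ≠ v) (hwu : w ≠ u) :
    ∃ p : (⊤ : SimpleGraph V).Path u v, w ∈ p.1.support ∧
      ∀ x ∈ p.1.support, x = u ∨ x = w ∨ x = v := by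
  by_cases hwv : w = v
  · subst hwv
    exact ⟨Path.singleton (by simpa using huv), by simp [Path.singleton],
      by simp [Path.singleton]⟩
  · refine ⟨⟨Walk.cons (v := w) (by simpa using hwu.symm)
      (Walk.cons (by simpa using hwv) Walk.nil), ?_⟩, ?_, ?_⟩
    · simp [Walk.isPath_def, hwv, huv, hwu.symm]
    · simp
    · simp

theorem maxDisjointPaths_top {V : Type*} [Fintype V] {u v : V} (huv : u ≠ v) :
    maxDisjointPaths (⊤ : SimpleGraph V) u v = Fintype.card V - 1 := by
  classical
  apply le_antisymm
  · simpa using maxDisjointPaths_le_degree (⊤ : SimpleGraph V) huv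
  · refine le_csSup ⟨_, fun m ⟨f, hf, hd⟩ => card_le_degree_of_internallyDisjoint huv f hf hd⟩ ?_
    choose p hp hp' using fun w : {w : V // w ≠ u} => exists_path_top_through huv w.2
    have hcard : Fintype.card {w : V // w ≠ u} = Fintype.card V - 1 := by simp
    let e : Fin (Fintype.card V - 1) ≃ {w : V // w ≠ u} := (Fintype.equivFinOfCardEq hcard).symm
    refine ⟨fun i => p (e i), ?_, ?_⟩
    · refine Function.Injective.comp (fun a b hab => Subtype.ext ?_) e.injective
      have h₁ := hp' b a (hab ▸ hp a)
      have h₂ := hp' a b (hab ▸ hp b)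
      have := a.2
      have := b.2
      grind
    · intro i j hij x hxi hxj
      have hne : (e i : V) ≠ e j := fun h => hij (e.injective (Subtype.ext h))
      have h₁ := hp' _ x hxi
      have h₂ := hp' _ x hxj
      grind

theorem isRoot_charpoly_iff_exists_mulVec {ι K : Type*} [Fintype ι] [DecidableEq ι] [Field K]
    (A : Matrix ι ι K) (μ : K) :
    A.charpoly.IsRoot μ ↔ ∃ x : ι → K, x ≠ 0 ∧ A.mulVec x = μ • x := by
  rw [IsRoot.def, Matrix.eval_charpoly, ← Matrix.exists_mulVec_eq_zero_iff]
  simp only [Matrix.sub_mulVec, sub_eq_zero, Matrix.scalar_apply, ← Matrix.smul_one_eq_diagonal,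
    Matrix.smul_mulVec, Matrix.one_mulVec, eq_comm]

section PathMatrix

variable {n : ℕ} (G : SimpleGraph (Fin n))

theorem pathMatrix_nonneg (i j : Fin n) : 0 ≤ pathMatrix G i j := by
  simp only [pathMatrix, Matrix.of_apply]
  split_ifs <;> positivity

theorem pathMatrix_le_degree [DecidableRel G.Adj] (i j : Fin n) :
    pathMatrix G i j ≤ G.degree i := by
  simp only [pathMatrix, Matrix.of_apply]
  split_ifs with h
  · positivity
  · exact_mod_cast maxDisjointPaths_le_degree G h

theorem pathMatrix_le (i j : Fin n) : pathMatrix G i j ≤ (n : ℝ) - 1 := by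
  classical
  refine (pathMatrix_le_degree G i j).trans ?_
  have h : G.degree i + 1 ≤ n := by simpa using G.degree_lt_card_verts i
  have h' : (G.degree i : ℝ) + 1 ≤ n := by exact_mod_cast h
  linarith

theorem pathMatrix_self (i : Fin n) : pathMatrix G i i = 0 := by
  simp [pathMatrix]

variable {G}

/-- The coordinatewise bound obtained by taking absolute values in the eigenvalue equation. -/
theorem mul_abs_le_sum_pathMatrix {μ : ℝ} {x : Fin n → ℝ}
    (hx : (pathMatrix G).mulVec x = μ • x) (i : Fin n) :
    μ * |x i| ≤ ∑ j ∈ Finset.univ.erase i, pathMatrix G i j * |x j| := by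
  have hi : ∑ j, pathMatrix G i j * x j = μ * x i := by
    simpa [Matrix.mulVec, dotProduct] using congrFun hx i
  calc μ * |x i| ≤ |μ| * |x i| := by gcongr; exact le_abs_self μ
    _ = |∑ j, pathMatrix G i j * x j| := by rw [hi, abs_mul]
    _ ≤ ∑ j, |pathMatrix G i j * x j| := Finset.abs_sum_le_sum_abs _ _
    _ = ∑ j, pathMatrix G i j * |x j| := by
      simp only [abs_mul, abs_of_nonneg (pathMatrix_nonneg G _ _)]
    _ = _ := by
      rw [← Finset.add_sum_erase _ _ (Finset.mem_univ i), pathMatrix_self, zero_mul, zero_add]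

theorem sum_erase_const_eq (i : Fin n) (c : ℝ) :
    ∑ _j ∈ Finset.univ.erase i, ((n : ℝ) - 1) * c = ((n : ℝ) - 1) ^ 2 * c := by
  have hn : 1 ≤ n := i.pos
  rw [Finset.sum_const, Finset.card_erase_of_mem (Finset.mem_univ i), Finset.card_univ,
    Fintype.card_fin, nsmul_eq_mul, Nat.cast_sub hn]
  push_cast
  ring

theorem exists_abs_maximal {x : Fin n → ℝ} (hx : x ≠ 0) :
    ∃ i, 0 < |x i| ∧ ∀ j, |x j| ≤ |x i| := by
  obtain ⟨k, hk⟩ := Function.ne_iff.1 hx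
  obtain ⟨i, -, hi⟩ := Finset.exists_max_image Finset.univ (fun j => |x j|) ⟨k, Finset.mem_univ k⟩
  exact ⟨i, (abs_pos.2 hk).trans_le (hi k (Finset.mem_univ k)), fun j => hi j (Finset.mem_univ j)⟩

theorem pathMatrix_mul_abs_le {x : Fin n → ℝ} {i : Fin n} (hi : ∀ j, |x j| ≤ |x i|) (j : Fin n) :
    pathMatrix G i j * |x j| ≤ ((n : ℝ) - 1) * |x i| :=
  mul_le_mul (pathMatrix_le G i j) (hi j) (abs_nonneg _)
    ((pathMatrix_nonneg G i j).trans (pathMatrix_le G i j))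

theorem le_of_isRoot_charpoly_pathMatrix {μ : ℝ} (hμ : (pathMatrix G).charpoly.IsRoot μ) :
    μ ≤ ((n : ℝ) - 1) ^ 2 := by
  obtain ⟨x, hx0, hx⟩ := (isRoot_charpoly_iff_exists_mulVec _ _).1 hμ
  obtain ⟨i, hpos, hi⟩ := exists_abs_maximal hx0
  refine le_of_mul_le_mul_right ?_ hpos
  rw [← sum_erase_const_eq i]
  exact (mul_abs_le_sum_pathMatrix hx i).trans
    (Finset.sum_le_sum fun j _ => pathMatrix_mul_abs_le hi j)

theorem eq_top_of_isRoot_charpoly_pathMatrix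
    (h : (pathMatrix G).charpoly.IsRoot (((n : ℝ) - 1) ^ 2)) : G = ⊤ := by
  classical
  obtain ⟨x, hx0, hx⟩ := (isRoot_charpoly_iff_exists_mulVec _ _).1 h
  obtain ⟨i, hpos, hi⟩ := exists_abs_maximal hx0
  have key (k : Fin n) (hk : ∀ j, |x j| ≤ |x k|) (j : Fin n) (hj : j ≠ k) :
      pathMatrix G k j * |x j| = ((n : ℝ) - 1) * |x k| := by
    refine (Finset.sum_eq_sum_iff_of_le fun j _ => pathMatrix_mul_abs_le hk j).1 ?_ j
      (Finset.mem_erase.2 ⟨hj, Finset.mem_univ j⟩)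
    refine le_antisymm (Finset.sum_le_sum fun j _ => pathMatrix_mul_abs_le hk j) ?_
    rw [sum_erase_const_eq]
    exact mul_abs_le_sum_pathMatrix hx k
  have hn {a b : Fin n} (hab : a ≠ b) : 0 < (n : ℝ) - 1 := by
    have h2 : 1 < n := by omega
    have : (1 : ℝ) < n := by exact_mod_cast h2
    linarith
  have hconst (j : Fin n) : |x j| = |x i| := by
    by_cases hj : j = i
    · rw [hj]
    · refine le_antisymm (hi j) (le_of_mul_le_mul_left ?_ (hn hj))
      rw [← key i hi j hj]
      exact mul_le_mul_of_nonneg_right (pathMatrix_le G i j) (abs_nonneg _)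
  rw [eq_top_iff]
  intro u v huv
  have huv' : u ≠ v := by simpa using huv
  have hu := key u (fun j => by rw [hconst j, hconst u]) v huv'.symm
  rw [hconst u, hconst v] at hu
  have hdeg : (n : ℝ) - 1 ≤ G.degree u :=
    (mul_right_cancel₀ hpos.ne' hu) ▸ pathMatrix_le_degree G u v
  have hdeg' : n ≤ G.degree u + 1 := by
    have : (n : ℝ) ≤ G.degree u + 1 := by linarith
    exact_mod_cast this
  by_contra hadj
  have hlt : G.neighborFinset u ⊆ (Finset.univ.erase u).erase v := by
    intro w hw
    rw [mem_neighborFinset] at hw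
    simp only [Finset.mem_erase, Finset.mem_univ, and_true]
    exact ⟨fun h => hadj (h ▸ hw), hw.ne'⟩
  have hle := Finset.card_le_card hlt
  rw [Finset.card_erase_of_mem (by simp [huv'.symm]), Finset.card_erase_of_mem (by simp),
    Finset.card_univ, Fintype.card_fin, card_neighborFinset_eq_degree] at hle
  have : 1 < n := by omega
  omega

theorem isRoot_charpoly_pathMatrix_top (hn : n ≠ 0) :
    (pathMatrix (⊤ : SimpleGraph (Fin n))).charpoly.IsRoot (((n : ℝ) - 1) ^ 2) := by
  refine (isRoot_charpoly_iff_exists_mulVec _ _).2 ⟨fun _ => 1, ?_, ?_⟩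
  · exact Function.ne_iff.2 ⟨⟨0, Nat.pos_of_ne_zero hn⟩, one_ne_zero⟩
  · ext i
    have hs : ∑ j, pathMatrix (⊤ : SimpleGraph (Fin n)) i j = ((n : ℝ) - 1) ^ 2 * 1 := by
      rw [← Finset.add_sum_erase _ _ (Finset.mem_univ i), pathMatrix_self, zero_add,
        ← sum_erase_const_eq i]
      refine Finset.sum_congr rfl fun j hj => ?_
      have hij : i ≠ j := (Finset.ne_of_mem_erase hj).symm
      simp [pathMatrix, hij, maxDisjointPaths_top hij,
        Nat.cast_sub (Nat.one_le_iff_ne_zero.2 hn)]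
    simpa [Matrix.mulVec, dotProduct] using hs

end PathMatrix

/-- for a connected graph on n vertices, ρ(G) ≤ (n − 1)²,
with equality iff G is the complete graph. -/
theorem path_spectral_radius_upper_bound {n : ℕ} (G : SimpleGraph (Fin n))
    (hG : G.Connected) :
    pathSpectralRadius G ≤ ((n : ℝ) - 1) ^ 2 ∧
      (pathSpectralRadius G = ((n : ℝ) - 1) ^ 2 ↔ G = ⊤) := by
  have hn : n ≠ 0 := by
    obtain ⟨i⟩ := hG.nonempty
    exact i.pos.ne'
  have hub : ∀ μ ∈ {x : ℝ | (pathMatrix G).charpoly.IsRoot x}, μ ≤ ((n : ℝ) - 1) ^ 2 :=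
    fun μ hμ => le_of_isRoot_charpoly_pathMatrix hμ
  refine ⟨Real.sSup_le hub (sq_nonneg _), fun h => ?_, ?_⟩
  · rcases Set.eq_empty_or_nonempty {x : ℝ | (pathMatrix G).charpoly.IsRoot x} with he | hne
    · rw [pathSpectralRadius, he, Real.sSup_empty] at h
      have h1 : (n : ℝ) = 1 := by
        have := pow_eq_zero_iff (two_ne_zero) |>.1 h.symm
        linarith
      have h1' : n = 1 := by exact_mod_cast h1
      subst h1'
      exact Subsingleton.elim _ _
    · refine eq_top_of_isRoot_charpoly_pathMatrix ?_
      rw [← h]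
      exact hne.csSup_mem (finite_setOfPred_isRoot (pathMatrix G).charpoly_monic.ne_zero)
  · rintro rfl
    exact IsGreatest.csSup_eq ⟨isRoot_charpoly_pathMatrix_top hn, hub⟩
end

section
/- Let G be a connected simple graph on n vertices. Then the path energy satisfies PE(G) ≥ 2(n − 1), with equality if and only if G is a tree (i.e., G is connected and acyclic). -/
open SimpleGraph Polynomial

/-- The quadratic form of a traceless Hermitian real matrix is at most half the sum of the
absolute values of the eigenvalues times the squared norm of the argument. -/
theorem Matrix.IsHermitian.two_mul_dotProduct_mulVec_le {n : Type*} [Fintype n]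
    [DecidableEq n] {A : Matrix n n ℝ} (hA : A.IsHermitian) (h0 : A.trace = 0) (v : n → ℝ) :
    2 * (v ⬝ᵥ A.mulVec v) ≤ (∑ i, |hA.eigenvalues i|) * (v ⬝ᵥ v) := by
  set c : n → ℝ := fun i => (hA.eigenvectorBasis i).ofLp ⬝ᵥ v with hc
  have hinner : ∀ (x : n → ℝ) i,
      inner ℝ (hA.eigenvectorBasis i) (WithLp.toLp 2 x) =
        (hA.eigenvectorBasis i).ofLp ⬝ᵥ x := by
    intro x i
    simp [PiLp.inner_apply, dotProduct, mul_comm]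
  have hparseval : ∀ x y : n → ℝ, x ⬝ᵥ y =
      ∑ i, ((hA.eigenvectorBasis i).ofLp ⬝ᵥ x) * ((hA.eigenvectorBasis i).ofLp ⬝ᵥ y) := by
    intro x y
    have h := hA.eigenvectorBasis.sum_inner_mul_inner (WithLp.toLp 2 x) (WithLp.toLp 2 y)
    simp only [real_inner_comm (hA.eigenvectorBasis _) (WithLp.toLp 2 x), hinner] at h
    rw [h]
    simp [PiLp.inner_apply, dotProduct, mul_comm]
  have hform : v ⬝ᵥ A.mulVec v = ∑ i, hA.eigenvalues i * c i ^ 2 := by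
    rw [hparseval]
    refine Finset.sum_congr rfl fun i _ => ?_
    have hsymm : A.transpose = A := by
      simpa [Matrix.IsHermitian, Matrix.conjTranspose_eq_transpose_of_trivial] using hA
    have : (hA.eigenvectorBasis i).ofLp ⬝ᵥ A.mulVec v = hA.eigenvalues i * c i := by
      rw [Matrix.dotProduct_mulVec, ← Matrix.mulVec_transpose, hsymm,
        hA.mulVec_eigenvectorBasis, smul_dotProduct, smul_eq_mul]
    rw [this]
    ring
  have hnorm : v ⬝ᵥ v = ∑ i, c i ^ 2 := by
    rw [hparseval]
    exact Finset.sum_congr rfl fun i _ => (sq _).symm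
  have htrace : ∑ i, hA.eigenvalues i = 0 := by
    simpa [h0] using hA.trace_eq_sum_eigenvalues.symm
  have hpos : ∑ i, |hA.eigenvalues i| = ∑ i, (|hA.eigenvalues i| + hA.eigenvalues i) := by
    rw [Finset.sum_add_distrib, htrace, add_zero]
  rw [hpos, hform, Finset.mul_sum, Finset.sum_mul]
  refine Finset.sum_le_sum fun i _ => ?_
  have hle : c i ^ 2 ≤ v ⬝ᵥ v := by
    rw [hnorm]
    exact Finset.single_le_sum (f := fun j => c j ^ 2) (fun j _ => sq_nonneg _)
      (Finset.mem_univ i)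
  have h1 := le_abs_self (hA.eigenvalues i)
  have h2 := neg_abs_le (hA.eigenvalues i)
  nlinarith [sq_nonneg (c i)]

theorem bddAbove_disjointPaths {V : Type*} [Finite V] (G : SimpleGraph V) (u v : V) :
    BddAbove {m : ℕ | ∃ f : Fin m → G.Path u v, Function.Injective f ∧
      ∀ i j, i ≠ j → InternallyDisjoint (f i).1 (f j).1} := by
  classical
  have := Fintype.ofFinite V
  refine ⟨Nat.card (G.Path u v), ?_⟩
  rintro m ⟨f, hf, -⟩
  simpa using Nat.card_le_card_of_injective f hf

theorem one_le_maxDisjointPaths {V : Type*} [Finite V] {G : SimpleGraph V} {u v : V}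
    (h : G.Reachable u v) : 1 ≤ maxDisjointPaths G u v := by
  obtain ⟨p, hp⟩ := h.exists_isPath
  exact le_csSup (bddAbove_disjointPaths G u v)
    ⟨fun _ => ⟨p, hp⟩, Function.injective_of_subsingleton _,
      fun i j hij => (hij (Subsingleton.elim i j)).elim⟩

theorem SimpleGraph.IsAcyclic.maxDisjointPaths_le_one {V : Type*} {G : SimpleGraph V}
    (h : G.IsAcyclic) (u v : V) : maxDisjointPaths G u v ≤ 1 := by
  refine csSup_le' ?_
  rintro m ⟨f, hf, -⟩
  by_contra! hm
  have := @hf ⟨0, by omega⟩ ⟨1, by omega⟩ ((h.subsingleton_path u v).elim _ _)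
  simp at this

/-- A graph with a cycle has two distinct vertices joined by two disjoint paths: the endpoints
of an edge of the cycle. -/
theorem isAcyclic_of_maxDisjointPaths_le_one {V : Type*} [Finite V] {G : SimpleGraph V}
    (h : ∀ u v, u ≠ v → maxDisjointPaths G u v ≤ 1) : G.IsAcyclic := by
  intro u c hc
  cases c with
  | nil => exact hc.ne_nil rfl
  | @cons _ v _ huv p =>
    obtain ⟨hp, he⟩ := Walk.cons_isCycle_iff p huv |>.1 hc
    have hq : (Walk.cons huv.symm Walk.nil : G.Walk v u).IsPath := by
      simp [huv.ne']
    have hne : p ≠ Walk.cons huv.symm Walk.nil := by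
      rintro rfl
      simp [Sym2.eq_swap] at he
    have hdisj : ∀ w, w ∈ p.support →
        w ∈ (Walk.cons huv.symm Walk.nil : G.Walk v u).support → w = v ∨ w = u := by
      intro w _ hw
      simpa using hw
    have h2 : 2 ≤ maxDisjointPaths G v u := by
      refine le_csSup (bddAbove_disjointPaths G v u)
        ⟨![⟨p, hp⟩, ⟨Walk.cons huv.symm Walk.nil, hq⟩], ?_, ?_⟩
      · intro i j hij
        fin_cases i <;> fin_cases j <;> simp_all [Subtype.ext_iff]
      · intro i j hij
        fin_cases i <;> fin_cases j
        · exact (hij rfl).elim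
        · exact hdisj
        · exact fun w h1 h2 => hdisj w h2 h1
        · exact (hij rfl).elim
    have := h v u huv.ne'
    omega

theorem maxDisjointPaths_comm {V : Type*} (G : SimpleGraph V) (u v : V) :
    maxDisjointPaths G u v = maxDisjointPaths G v u := by
  have key : ∀ u v : V, ∀ m : ℕ, (∃ f : Fin m → G.Path u v, Function.Injective f ∧
      ∀ i j, i ≠ j → InternallyDisjoint (f i).1 (f j).1) →
      ∃ f : Fin m → G.Path v u, Function.Injective f ∧
      ∀ i j, i ≠ j → InternallyDisjoint (f i).1 (f j).1 := by
    rintro u v m ⟨f, hf, hd⟩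
    refine ⟨fun i => (f i).reverse, fun i j hij => hf ?_, fun i j hij w h1 h2 => ?_⟩
    · have := congrArg (fun q : G.Path v u => q.1.reverse) hij
      exact Subtype.ext (by simpa using this)
    · exact (hd i j hij w (by simpa using h1) (by simpa using h2)).symm
  exact congrArg sSup (Set.ext fun m => ⟨key u v m, key v u m⟩)

theorem isHermitian_pathMatrix {n : ℕ} (G : SimpleGraph (Fin n)) :
    (pathMatrix G).IsHermitian := by
  ext i j
  simp [pathMatrix, eq_comm, maxDisjointPaths_comm G i j]

theorem trace_pathMatrix {n : ℕ} (G : SimpleGraph (Fin n)) : (pathMatrix G).trace = 0 := by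
  simp [Matrix.trace, pathMatrix]

theorem pathEnergy_eq_sum_abs_eigenvalues {n : ℕ} (G : SimpleGraph (Fin n)) :
    pathEnergy G = ∑ i, |(isHermitian_pathMatrix G).eigenvalues i| := by
  simp [pathEnergy, (isHermitian_pathMatrix G).roots_charpoly_eq_eigenvalues, List.sum_ofFn]

/-- Twice the sum of the entries of the path matrix is at most `n` times the path energy. -/
theorem two_mul_sum_pathMatrix_le {n : ℕ} (G : SimpleGraph (Fin n)) :
    2 * ∑ i, ∑ j, pathMatrix G i j ≤ pathEnergy G * n := by
  have h := (isHermitian_pathMatrix G).two_mul_dotProduct_mulVec_le (trace_pathMatrix G) 1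
  simpa [pathEnergy_eq_sum_abs_eigenvalues, dotProduct, Matrix.mulVec] using h

theorem sum_one_sub_one_apply (n : ℕ) :
    ∑ i : Fin n, ∑ j : Fin n, (if i = j then (0 : ℝ) else 1) = n * (n - 1) := by
  have : ∀ i j : Fin n, (if i = j then (0 : ℝ) else 1) = 1 - if i = j then 1 else 0 := by
    intro i j
    split_ifs <;> simp
  simp [this]
  ring

theorem SimpleGraph.Connected.le_pathMatrix {n : ℕ} {G : SimpleGraph (Fin n)}
    (hG : G.Connected) (i j : Fin n) : (if i = j then (0 : ℝ) else 1) ≤ pathMatrix G i j := by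
  by_cases h : i = j
  · simp [pathMatrix, h]
  · simpa [pathMatrix, h] using one_le_maxDisjointPaths (hG i j)

theorem SimpleGraph.IsTree.pathMatrix_apply {n : ℕ} {G : SimpleGraph (Fin n)}
    (hG : G.IsTree) (i j : Fin n) : pathMatrix G i j = if i = j then 0 else 1 := by
  have h := le_antisymm (hG.isAcyclic.maxDisjointPaths_le_one i j)
    (one_le_maxDisjointPaths (hG.connected i j))
  simp [pathMatrix, h]

theorem SimpleGraph.IsTree.pathEnergy_eq {n : ℕ} {G : SimpleGraph (Fin n)} (hG : G.IsTree) :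
    pathEnergy G = 2 * ((n : ℝ) - 1) := by
  have hn : 1 ≤ n := Fin.pos_iff_nonempty.2 hG.connected.nonempty
  have hn' : (1 : ℝ) ≤ n := by exact_mod_cast hn
  set hA := isHermitian_pathMatrix G
  have hmul : ∀ v : Fin n → ℝ, (pathMatrix G).mulVec v = fun i => (∑ j, v j) - v i := by
    intro v
    ext i
    have : ∀ j, pathMatrix G i j = 1 - if i = j then 1 else 0 := by
      intro j
      rw [hG.pathMatrix_apply]
      split_ifs <;> simp
    simp [Matrix.mulVec, dotProduct, this, sub_mul]
  have heig : ∀ i, hA.eigenvalues i = -1 ∨ hA.eigenvalues i = n - 1 := by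
    intro i
    have hv := hA.mulVec_eigenvectorBasis i
    rw [hmul] at hv
    set v := (hA.eigenvectorBasis i).ofLp with hvdef
    have hv' : ∀ k, ∑ j, v j = (hA.eigenvalues i + 1) * v k := by
      intro k
      have := congrFun hv k
      simp only [Pi.smul_apply, smul_eq_mul] at this
      linarith
    have hsum : (n : ℝ) * ∑ j, v j = (hA.eigenvalues i + 1) * ∑ j, v j := by
      conv_rhs => rw [Finset.mul_sum]
      simp [← hv']
    by_cases hs : ∑ j, v j = 0
    · left
      obtain ⟨k, hk⟩ : ∃ k, v k ≠ 0 := by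
        by_contra! h0
        refine hA.eigenvectorBasis.orthonormal.ne_zero i ?_
        ext k
        exact h0 k
      have := hv' k
      rw [hs, eq_comm, mul_eq_zero] at this
      linarith [this.resolve_right hk]
    · right
      linarith [mul_right_cancel₀ hs hsum]
  have htrace : ∑ i, hA.eigenvalues i = 0 := by
    simpa [trace_pathMatrix] using hA.trace_eq_sum_eigenvalues.symm
  have habs : ∀ i, |hA.eigenvalues i| =
      (n - 2) / n * hA.eigenvalues i + (2 * n - 2) / n := by
    intro i
    rcases heig i with h | h <;> rw [h]
    · rw [abs_neg, abs_one]
      field_simp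
      ring
    · rw [abs_of_nonneg (by linarith)]
      field_simp
      ring
  rw [pathEnergy_eq_sum_abs_eigenvalues, Finset.sum_congr rfl fun i _ => habs i,
    Finset.sum_add_distrib, ← Finset.mul_sum, htrace]
  simp
  field_simp

/-- for a connected graph on n vertices, PE(G) ≥ 2(n − 1),
with equality iff G is a tree. -/
theorem pathEnergy_lower_bound {n : ℕ} (G : SimpleGraph (Fin n))
    (hG : G.Connected) :
    2 * ((n : ℝ) - 1) ≤ pathEnergy G ∧
      (pathEnergy G = 2 * ((n : ℝ) - 1) ↔ G.IsTree) := by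
  have hn : (0 : ℝ) < n := by exact_mod_cast Fin.pos_iff_nonempty.2 hG.nonempty
  have hle := two_mul_sum_pathMatrix_le G
  have hrow : ∀ i ∈ Finset.univ, ∑ j, (if i = j then (0 : ℝ) else 1) ≤ ∑ j, pathMatrix G i j :=
    fun i _ => Finset.sum_le_sum fun j _ => hG.le_pathMatrix i j
  have hsum := Finset.sum_le_sum hrow
  refine ⟨?_, fun h => ⟨hG, isAcyclic_of_maxDisjointPaths_le_one fun i j hij => ?_⟩,
    fun h => h.pathEnergy_eq⟩
  · rw [sum_one_sub_one_apply] at hsum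
    exact le_of_mul_le_mul_right (by linarith) hn
  · have heq := le_antisymm hsum (by rw [sum_one_sub_one_apply]; rw [h] at hle; linarith)
    have hi := (Finset.sum_eq_sum_iff_of_le hrow).1 heq i (Finset.mem_univ i)
    have hj := (Finset.sum_eq_sum_iff_of_le fun j _ => hG.le_pathMatrix i j).1 hi j
      (Finset.mem_univ j)
    simp only [pathMatrix, Matrix.of_apply, if_neg hij] at hj
    exact_mod_cast hj.ge
end

section
/- Let G be a unicyclic simple graph on n vertices with cycle length k, where 3 ≤ k ≤ n − 1. Then the path spectral radius of G equals ρ(G) = ( (n + k − 3) + √((n + k − 3)² + 4(k² − nk + 2n − 2)) ) / 2. -/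
open SimpleGraph Polynomial

namespace SimpleGraph

variable {V : Type*} {G : SimpleGraph V}

/-- In a connected graph with as many edges as vertices, all cycles have the same edges. -/
theorem Walk.IsCycle.edges_subset_of_card_edgeSet_eq [Finite V] (hG : G.Connected)
    (hcard : Nat.card G.edgeSet = Nat.card V) {x y : V} {c : G.Walk x x} {d : G.Walk y y}
    (hc : c.IsCycle) (hd : d.IsCycle) : c.edges ⊆ d.edges := by
  intro e he
  by_contra hed
  have hmem : e ∈ G.edgeSet := c.edges_subset_edgeSet he
  have hbridge : ¬ G.IsBridge e := fun hb => hb.notMem_edges_of_isCycle hc he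
  have hconn : (G.deleteEdges {e}).Connected := by
    induction e with
    | h a b => exact hG.connected_delete_edge_of_not_isBridge hbridge
  have hcard' : Nat.card (G.deleteEdges {e}).edgeSet + 1 = Nat.card V := by
    rw [← hcard, edgeSet_deleteEdges, Nat.card_coe_set_eq, Nat.card_coe_set_eq]
    exact Set.ncard_sdiff_singleton_add_one hmem (Set.toFinite _)
  have htree := isTree_iff_connected_and_card.mpr ⟨hconn, hcard'⟩
  refine htree.isAcyclic _ (Walk.IsCycle.toDeleteEdges G {e} hd ?_)
  rintro f hf rfl
  exact hed hf

/-- Two distinct internally disjoint paths with the same endpoints form a cycle. -/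
theorem Walk.IsPath.isCycle_append_reverse {u v : V} {p q : G.Walk u v} (hp : p.IsPath)
    (hq : q.IsPath) (hpq : p ≠ q) (hdisj : InternallyDisjoint p q) :
    (p.append q.reverse).IsCycle := by
  refine hp.isCycle_append (isPath_reverse_iff q |>.mpr hq) (fun w hw hw' ↦ ?_) ?_
  · have := hdisj w
    grind [dropLast_support_concat, IsPath.support_nodup, support_reverse, cons_tail_support]
  · grind [length_reverse, eq_of_length_le_one]

/-- Two distinct internally disjoint paths with the same endpoints have no common edge. -/
theorem Walk.IsPath.disjoint_edges_of_internallyDisjoint {u v : V} {p q : G.Walk u v}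
    (hp : p.IsPath) (hq : q.IsPath) (hpq : p ≠ q) (hdisj : InternallyDisjoint p q) :
    p.edges.Disjoint q.edges := by
  have h := (hp.isCycle_append_reverse hq hpq hdisj).isTrail.edges_nodup
  rw [edges_append, edges_reverse] at h
  simpa using List.disjoint_of_nodup_append h

theorem Walk.IsCycle.support_subset_of_card_edgeSet_eq [Finite V] (hG : G.Connected)
    (hcard : Nat.card G.edgeSet = Nat.card V) {x y : V} {c : G.Walk x x} {d : G.Walk y y}
    (hc : c.IsCycle) (hd : d.IsCycle) : c.support ⊆ d.support := by
  intro w hw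
  obtain ⟨e, he, hwe⟩ := (mem_support_iff_exists_mem_edges_of_not_nil hc.not_nil).mp hw
  exact (mem_support_iff_exists_mem_edges_of_not_nil hd.not_nil).mpr
    ⟨e, hc.edges_subset_of_card_edgeSet_eq hG hcard hd he, hwe⟩

/-- Two distinct vertices of a cycle are joined by two distinct internally disjoint paths. -/
theorem Walk.IsCycle.exists_internallyDisjoint {x u v : V} {c : G.Walk x x} (hc : c.IsCycle)
    (hu : u ∈ c.support) (hv : v ∈ c.support) (huv : u ≠ v) :
    ∃ p q : G.Path u v, p ≠ q ∧ InternallyDisjoint p.1 q.1 := by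
  classical
  have hd : (c.rotate u hu).IsCycle := hc.rotate hu
  have hvd : v ∈ (c.rotate u hu).support := (mem_support_rotate_iff ..).mpr hv
  obtain ⟨p, q, hpq⟩ := mem_support_iff_exists_append.mp hvd
  rw [hpq] at hd
  have hpn : ¬ p.Nil := not_nil_of_ne huv
  have hqn : ¬ q.Nil := not_nil_of_ne huv.symm
  have hp := hd.isPath_of_append_left hqn
  have hq := hd.isPath_of_append_right hpn
  have hsupp := hd.support_nodup
  rw [tail_support_append, List.nodup_append'] at hsupp
  have hint : InternallyDisjoint p q.reverse := by
    intro w hwp hwq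
    rw [support_reverse, List.mem_reverse] at hwq
    rcases p.mem_support_iff.mp hwp with h | h
    · exact Or.inl h
    rcases q.mem_support_iff.mp hwq with h' | h'
    · exact Or.inr h'
    · exact (hsupp.2.2 h h').elim
  refine ⟨⟨p, hp⟩, ⟨q.reverse, hq.reverse⟩, fun h => ?_, hint⟩
  have hedges := hd.isTrail.edges_nodup
  rw [edges_append] at hedges
  have hdis := List.disjoint_of_nodup_append hedges
  have heq : p = q.reverse := congrArg Subtype.val h
  obtain ⟨e, he, -⟩ := (mem_support_iff_exists_mem_edges_of_not_nil hpn).mp p.start_mem_support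
  refine hdis he ?_
  rw [heq, edges_reverse, List.mem_reverse] at he
  exact he

theorem Walk.IsCycle.card_support_toFinset [DecidableEq V] {x : V} {c : G.Walk x x}
    (hc : c.IsCycle) : c.support.toFinset.card = c.length := by
  have h : c.support.toFinset = c.support.tail.toFinset := by
    ext w
    simp only [List.mem_toFinset]
    refine ⟨fun hw => ?_, List.mem_of_mem_tail⟩
    rcases c.mem_support_iff.mp hw with rfl | hw
    · exact c.end_mem_tail_support hc.not_nil
    · exact hw
  rw [h, List.toFinset_card_of_nodup hc.support_nodup]
  simp

/-- In a unicyclic graph, two vertices are joined by at most two internally disjoint paths, and by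
at most one if they do not both lie on the cycle. -/
theorem card_disjointPaths_le [Finite V] (hG : G.Connected)
    (hcard : Nat.card G.edgeSet = Nat.card V) {x u v : V} (huv : u ≠ v) {c : G.Walk x x}
    (hc : c.IsCycle) {m : ℕ} (f : Fin m → G.Path u v) (hf : Function.Injective f)
    (hdisj : ∀ i j, i ≠ j → InternallyDisjoint (f i).1 (f j).1) :
    m ≤ 2 ∧ (¬ (u ∈ c.support ∧ v ∈ c.support) → m ≤ 1) := by
  have hne : ∀ i j, i ≠ j → (f i).1 ≠ (f j).1 := fun i j hij h => hij (hf (Subtype.ext h))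
  have hcyc : ∀ i j, i ≠ j → ((f i).1.append (f j).1.reverse).IsCycle := fun i j hij =>
    (f i).2.isCycle_append_reverse (f j).2 (hne i j hij) (hdisj i j hij)
  have hedge : ∀ i j, i ≠ j → (f i).1.edges.Disjoint (f j).1.edges := fun i j hij =>
    (f i).2.disjoint_edges_of_internallyDisjoint (f j).2 (hne i j hij) (hdisj i j hij)
  constructor
  · by_contra! hm
    obtain ⟨i, hi⟩ : ∃ i : Fin m, i.1 = 0 := ⟨⟨0, by omega⟩, rfl⟩
    obtain ⟨j, hj⟩ : ∃ i : Fin m, i.1 = 1 := ⟨⟨1, by omega⟩, rfl⟩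
    obtain ⟨l, hl⟩ : ∃ i : Fin m, i.1 = 2 := ⟨⟨2, by omega⟩, rfl⟩
    have hij : i ≠ j := by rintro rfl; omega
    have hil : i ≠ l := by rintro rfl; omega
    have hjl : j ≠ l := by rintro rfl; omega
    obtain ⟨e, he, -⟩ := (Walk.mem_support_iff_exists_mem_edges_of_not_nil
      (Walk.not_nil_of_ne huv)).mp (f i).1.start_mem_support
    have hmem := (hcyc i j hij).edges_subset_of_card_edgeSet_eq hG hcard (hcyc j l hjl)
      (a := e) (by simp [Walk.edges_append, he])
    rw [Walk.edges_append, Walk.edges_reverse, List.mem_append, List.mem_reverse] at hmem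
    exact hmem.elim (hedge i j hij he) (hedge i l hil he)
  · intro hnot
    by_contra! hm
    obtain ⟨i, hi⟩ : ∃ i : Fin m, i.1 = 0 := ⟨⟨0, by omega⟩, rfl⟩
    obtain ⟨j, hj⟩ : ∃ i : Fin m, i.1 = 1 := ⟨⟨1, by omega⟩, rfl⟩
    have hij : i ≠ j := by rintro rfl; omega
    have hsub := (hcyc i j hij).support_subset_of_card_edgeSet_eq hG hcard hc
    exact hnot ⟨hsub (by simp), hsub (by simp [Walk.mem_support_append_iff])⟩

/-- The entries of the path matrix of a unicyclic graph. -/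
theorem maxDisjointPaths_eq [Finite V] (hG : G.Connected)
    (hcard : Nat.card G.edgeSet = Nat.card V) {x u v : V} (huv : u ≠ v) {c : G.Walk x x}
    (hc : c.IsCycle) [Decidable (u ∈ c.support ∧ v ∈ c.support)] :
    maxDisjointPaths G u v = if u ∈ c.support ∧ v ∈ c.support then 2 else 1 := by
  refine IsGreatest.csSup_eq ⟨?_, ?_⟩
  · split_ifs with h
    · obtain ⟨p, q, hpq, hdisj⟩ := hc.exists_internallyDisjoint h.1 h.2 huv
      refine ⟨![p, q], ?_, ?_⟩
      · intro i j hij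
        fin_cases i <;> fin_cases j <;> simp_all [eq_comm]
      · intro i j hij
        fin_cases i <;> fin_cases j
        · exact (hij rfl).elim
        · exact hdisj
        · exact fun w hw hw' => hdisj w hw' hw
        · exact (hij rfl).elim
    · obtain ⟨p, hp⟩ := hG.exists_isPath u v
      exact ⟨fun _ => ⟨p, hp⟩, Function.injective_of_subsingleton _,
        fun i j hij => (hij (Subsingleton.elim i j)).elim⟩
  · rintro m ⟨f, hf, hdisj⟩
    have := card_disjointPaths_le hG hcard huv hc f hf hdisj
    split_ifs with h
    · exact this.1
    · exact this.2 h

end SimpleGraph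

namespace Matrix

variable {ι : Type*} [Fintype ι] [DecidableEq ι]

theorem isRoot_charpoly_iff_exists_mulVec_eq_smul {K : Type*} [Field K] (A : Matrix ι ι K)
    (t : K) : A.charpoly.IsRoot t ↔ ∃ v ≠ 0, A *ᵥ v = t • v := by
  rw [Polynomial.IsRoot.def, eval_charpoly, ← exists_mulVec_eq_zero_iff]
  refine exists_congr fun v => and_congr_right fun _ => ?_
  rw [sub_mulVec, sub_eq_zero, eq_comm, scalar_apply, ← smul_one_eq_diagonal, smul_mulVec,
    one_mulVec]

/-- The matrix with zero diagonal whose off-diagonal entries are `2` on `S × S` and `1`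
elsewhere. -/
def twoOneMatrix (S : Finset ι) : Matrix ι ι ℝ :=
  of fun i j => if i = j then 0 else if i ∈ S ∧ j ∈ S then 2 else 1

theorem twoOneMatrix_mulVec (S : Finset ι) (v : ι → ℝ) (i : ι) :
    (twoOneMatrix S *ᵥ v) i =
      (∑ j, v j) + (if i ∈ S then ∑ j ∈ S, v j else 0) - (if i ∈ S then 2 else 1) * v i := by
  have h : ∀ j, twoOneMatrix S i j * v j = v j + (if i ∈ S then if j ∈ S then v j else 0 else 0)
      - if i = j then (if i ∈ S then 2 else 1) * v j else 0 := by
    intro j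
    rw [twoOneMatrix, of_apply]
    by_cases hij : i = j
    · subst hij
      by_cases hi : i ∈ S <;> simp [hi]; ring
    · by_cases hi : i ∈ S <;> by_cases hj : j ∈ S <;> simp [hi, hj, hij]; ring
  rw [mulVec, dotProduct, Finset.sum_congr rfl fun j _ => h j, Finset.sum_sub_distrib,
    Finset.sum_add_distrib, Finset.sum_ite_eq]
  by_cases hi : i ∈ S <;> simp [hi]

/-- The largest eigenvalue of `twoOneMatrix S`. -/
theorem isGreatest_isRoot_charpoly_twoOneMatrix (S : Finset ι) {n k : ℕ}
    (hn : Fintype.card ι = n) (hk : S.card = k) (hk3 : 3 ≤ k) (hkn : k + 1 ≤ n) :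
    IsGreatest {t : ℝ | (twoOneMatrix S).charpoly.IsRoot t}
      ((((n : ℝ) + k - 3) + Real.sqrt (((n : ℝ) + k - 3) ^ 2
          + 4 * ((k : ℝ) ^ 2 - n * k + 2 * n - 2))) / 2) := by
  have hk3' : (3 : ℝ) ≤ k := by exact_mod_cast hk3
  have hkn' : (k : ℝ) + 1 ≤ n := by exact_mod_cast hkn
  have hcompl : (Sᶜ.card : ℝ) = n - k := by
    rw [Finset.card_compl, hn, hk, Nat.cast_sub (by omega)]
  have hdisc : 0 ≤ ((n : ℝ) + k - 3) ^ 2 + 4 * ((k : ℝ) ^ 2 - n * k + 2 * n - 2) := by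
    nlinarith [sq_nonneg (2 * (k : ℝ) - 2 - (n - k - 1)),
      mul_nonneg (by linarith : (0 : ℝ) ≤ k) (by linarith : (0 : ℝ) ≤ n - k)]
  have hsq := Real.sq_sqrt hdisc
  have hr := Real.sqrt_nonneg (((n : ℝ) + k - 3) ^ 2 + 4 * ((k : ℝ) ^ 2 - n * k + 2 * n - 2))
  generalize Real.sqrt (((n : ℝ) + k - 3) ^ 2 + 4 * ((k : ℝ) ^ 2 - n * k + 2 * n - 2)) = r
    at hsq hr
  constructor
  · rw [Set.mem_ofPred_eq, isRoot_charpoly_iff_exists_mulVec_eq_smul]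
    obtain ⟨ρ, hρ⟩ : ∃ ρ : ℝ, ρ = ((n : ℝ) + k - 3 + r) / 2 := ⟨_, rfl⟩
    rw [← hρ]
    have hquad : ρ ^ 2 - (n + k - 3) * ρ - ((k : ℝ) ^ 2 - n * k + 2 * n - 2) = 0 := by
      rw [hρ]; linarith
    let v : ι → ℝ := fun i => if i ∈ S then ρ - (n - k - 1) else k
    have hS : ∑ j ∈ S, v j = k * (ρ - (n - k - 1)) := by
      rw [Finset.sum_congr rfl fun j hj => if_pos hj, Finset.sum_const, hk, nsmul_eq_mul]
    have hSc : ∑ j ∈ Sᶜ, v j = (n - k) * k := by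
      rw [Finset.sum_congr rfl fun j hj => if_neg (Finset.mem_compl.mp hj), Finset.sum_const,
        nsmul_eq_mul, hcompl]
    refine ⟨v, fun hv => ?_, ?_⟩
    · obtain ⟨i, hi⟩ : ∃ i, i ∉ S := by
        by_contra! hall
        rw [Finset.eq_univ_of_forall hall, Finset.card_univ] at hk
        omega
      have := congrFun hv i
      simp only [v, if_neg hi, Pi.zero_apply] at this
      linarith
    · ext i
      rw [twoOneMatrix_mulVec, ← Finset.sum_add_sum_compl S, hS, hSc, Pi.smul_apply, smul_eq_mul]
      by_cases hi : i ∈ S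
      · simp only [v, if_pos hi]
        linarith
      · simp only [v, if_neg hi]
        ring
  · intro t ht
    rw [Set.mem_ofPred_eq, isRoot_charpoly_iff_exists_mulVec_eq_smul] at ht
    obtain ⟨v, hv, hAv⟩ := ht
    by_contra! hlt
    have hquad : 0 < (t + 2 - 2 * k) * (t + 1 - n + k) - k * (n - k) := by
      nlinarith
    have heq : ∀ i, (t + if i ∈ S then 2 else 1) * v i =
        ∑ j ∈ S, v j + ∑ j ∈ Sᶜ, v j + if i ∈ S then ∑ j ∈ S, v j else 0 := by
      intro i
      have := congrFun hAv i
      rw [twoOneMatrix_mulVec, ← Finset.sum_add_sum_compl S, Pi.smul_apply, smul_eq_mul] at this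
      linarith
    generalize hs : ∑ j ∈ S, v j = s at heq
    generalize hd : ∑ j ∈ Sᶜ, v j = d at heq
    have hsum : (t + 2) * s = k * (s + d + s) := by
      rw [← hs, Finset.mul_sum, hs, ← hk, ← nsmul_eq_mul, ← Finset.sum_const]
      exact Finset.sum_congr rfl fun i hi => by simpa [hi] using heq i
    have hsum' : (t + 1) * d = (n - k) * (s + d) := by
      rw [← hd, Finset.mul_sum, hd, ← hcompl, ← nsmul_eq_mul, ← Finset.sum_const]
      exact Finset.sum_congr rfl fun i hi => by
        simpa [Finset.mem_compl.mp hi] using heq i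
    have hs0 : s = 0 := by
      have : ((t + 2 - 2 * k) * (t + 1 - n + k) - k * (n - k)) * s = 0 := by
        linear_combination (t + 1 - n + k) * hsum + k * hsum'
      exact (mul_eq_zero.mp this).resolve_left hquad.ne'
    have hd0 : d = 0 := by
      have : (k : ℝ) * d = 0 := by linear_combination (t + 2 - 2 * k) * hs0 - hsum
      exact (mul_eq_zero.mp this).resolve_left (by linarith)
    refine hv (funext fun i => ?_)
    have hi := heq i
    rw [hs0, hd0, ite_self, add_zero, add_zero] at hi
    refine (mul_eq_zero.mp hi).resolve_left (ne_of_gt ?_)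
    split_ifs <;> linarith

end Matrix

/-- path spectral radius of a unicyclic graph on n vertices with
cycle length k, 3 ≤ k ≤ n − 1. -/
theorem pathSpectralRadius_unicyclic {n k : ℕ} (G : SimpleGraph (Fin n))
    (hG : G.Connected) (hedges : Nat.card G.edgeSet = n)
    (x : Fin n) (c : G.Walk x x) (hc : c.IsCycle) (hlen : c.length = k)
    (hk3 : 3 ≤ k) (hkn : k + 1 ≤ n) :
    pathSpectralRadius G =
      (((n : ℝ) + k - 3) +
        Real.sqrt (((n : ℝ) + k - 3) ^ 2
          + 4 * ((k : ℝ) ^ 2 - n * k + 2 * n - 2))) / 2 := by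
  have hcard : Nat.card G.edgeSet = Nat.card (Fin n) := by rw [hedges, Nat.card_fin]
  have hmat : pathMatrix G = Matrix.twoOneMatrix c.support.toFinset := by
    ext i j
    rw [pathMatrix, Matrix.twoOneMatrix, Matrix.of_apply, Matrix.of_apply]
    split_ifs with hij h
    · rfl
    · rw [maxDisjointPaths_eq hG hcard hij hc, if_pos (by simpa using h), Nat.cast_ofNat]
    · rw [maxDisjointPaths_eq hG hcard hij hc, if_neg (by simpa using h), Nat.cast_one]
  rw [pathSpectralRadius, hmat]
  exact (Matrix.isGreatest_isRoot_charpoly_twoOneMatrix _ (Fintype.card_fin n)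
    (hc.card_support_toFinset.trans hlen) hk3 hkn).csSup_eq
end
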